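/- arXiv:2502.15523 — 5 statements merged into one kernel-verified Lean document; each statement's English description precedes it below -/
import Mathlib

section
/- For every δ ∈ (0,1), the optimal δ-robust value satisfies OPT(δ) ≥ OPT − 2√δ + δ, where OPT is the value of an optimal (non-robust) contract. -/
open scoped BigOperators

/-- An instance of a hidden-action principal-agent problem with action set `A`
and outcome set `O`. -/
structure PAInstance (A O : Type*) [Fintype A] [Fintype O] [Nonempty A] [Nonempty O] where
  /-- `F a ω` is the probability that action `a` results in outcome `ω`. -/
  F : A → O → ℝ
  /-- principal's reward vector -/
  r : O → ℝ
  /-- agent's cost vector -/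
  c : A → ℝ
  F_nonneg : ∀ a ω, 0 ≤ F a ω
  F_sum : ∀ a, ∑ ω, F a ω = 1
  r_mem : ∀ ω, r ω ∈ Set.Icc (0 : ℝ) 1
  c_mem : ∀ a, c a ∈ Set.Icc (0 : ℝ) 1
  /-- the opt-out action -/
  optOut : A
  optOut_cost : c optOut = 0
  optOut_reward : ∑ ω, F optOut ω * r ω = 0

namespace PAInstance

variable {A O : Type*} [Fintype A] [Fintype O] [Nonempty A] [Nonempty O]

/-- A contract is a vector of nonnegative payments, one per outcome. -/
def IsContract (p : O → ℝ) : Prop := ∀ ω, 0 ≤ p ω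

/-- Agent's expected utility `u^A(p, a) = F_a · p - c_a`. -/
def uA (I : PAInstance A O) (p : O → ℝ) (a : A) : ℝ := (∑ ω, I.F a ω * p ω) - I.c a

/-- Principal's expected utility `u^P(p, a) = F_a · (r - p)`. -/
def uP (I : PAInstance A O) (p : O → ℝ) (a : A) : ℝ := ∑ ω, I.F a ω * (I.r ω - p ω)

/-- The set of (exact) best responses `A(p)`. -/
def BR (I : PAInstance A O) (p : O → ℝ) : Set A := {a | ∀ a', I.uA p a' ≤ I.uA p a}

/-- The set of `δ`-best responses
`A^δ(p) = {a : u^A(p,a) > max_{a'} u^A(p,a') - δ}`. -/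
def dBR (I : PAInstance A O) (δ : ℝ) (p : O → ℝ) : Set A :=
  {a | ∀ a', I.uA p a' - δ < I.uA p a}

/-- `Ψ_δ(p) = min_{a ∈ A^δ(p)} u^P(p, a)`, the principal's robust utility in `p`. -/
noncomputable def Psi (I : PAInstance A O) (δ : ℝ) (p : O → ℝ) : ℝ :=
  sInf (I.uP p '' I.dBR δ p)

/-- `OPT(δ)`: the optimal δ-robust value. -/
noncomputable def OPTrob (I : PAInstance A O) (δ : ℝ) : ℝ :=
  sSup {x | ∃ p, IsContract p ∧ x = I.Psi δ p}

/-- `OPT`: value of an optimal (non-robust) contract, where the agent breaks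
ties in favor of the principal. -/
noncomputable def OPT (I : PAInstance A O) : ℝ :=
  sSup {x | ∃ p, IsContract p ∧ x = sSup (I.uP p '' I.BR p)}

/-- `SW = max_a (F_a · r - c_a)`, the maximum social welfare. -/
noncomputable def SW (I : PAInstance A O) : ℝ :=
  sSup (Set.range fun a => (∑ ω, I.F a ω * I.r ω) - I.c a)

end PAInstance

namespace PAInstance

variable {A O : Type*} [Fintype A] [Fintype O] [Nonempty A] [Nonempty O]

theorem BR_nonempty (I : PAInstance A O) (p : O → ℝ) : (I.BR p).Nonempty :=
  Finite.exists_max (I.uA p)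

theorem BR_subset_dBR (I : PAInstance A O) {δ : ℝ} (hδ : 0 < δ) (p : O → ℝ) :
    I.BR p ⊆ I.dBR δ p := fun a ha a' => by
  have := ha a'
  linarith

theorem uP_le_one (I : PAInstance A O) {p : O → ℝ} (hp : IsContract p) (a : A) :
    I.uP p a ≤ 1 := by
  rw [← I.F_sum a]
  refine Finset.sum_le_sum fun ω _ => mul_le_of_le_one_right (I.F_nonneg a ω) ?_
  linarith [hp ω, (I.r_mem ω).2]

/-- Moving a contract towards the reward vector by a fraction `s` shares a fraction `s` of the
principal's utility with the agent. -/
theorem uA_interpolate (I : PAInstance A O) (s : ℝ) (p : O → ℝ) (a : A) :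
    I.uA (fun ω => (1 - s) * p ω + s * I.r ω) a = I.uA p a + s * I.uP p a := by
  have h : ∑ ω, I.F a ω * ((1 - s) * p ω + s * I.r ω) =
      ∑ ω, I.F a ω * p ω + s * ∑ ω, I.F a ω * (I.r ω - p ω) := by
    rw [Finset.mul_sum, ← Finset.sum_add_distrib]
    exact Finset.sum_congr rfl fun ω _ => by ring
  unfold uA uP
  rw [h]
  ring

theorem uP_interpolate (I : PAInstance A O) (s : ℝ) (p : O → ℝ) (a : A) :
    I.uP (fun ω => (1 - s) * p ω + s * I.r ω) a = (1 - s) * I.uP p a := by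
  unfold uP
  rw [Finset.mul_sum]
  exact Finset.sum_congr rfl fun ω _ => by ring

theorem Psi_le_one (I : PAInstance A O) {δ : ℝ} (hδ : 0 < δ) {p : O → ℝ} (hp : IsContract p) :
    I.Psi δ p ≤ 1 := by
  obtain ⟨a, ha⟩ := I.BR_nonempty p
  exact (csInf_le (Set.toFinite _).bddBelow
    (Set.mem_image_of_mem _ (I.BR_subset_dBR hδ p ha))).trans (I.uP_le_one hp a)

theorem Psi_le_OPTrob (I : PAInstance A O) {δ : ℝ} (hδ : 0 < δ) {p : O → ℝ}
    (hp : IsContract p) : I.Psi δ p ≤ I.OPTrob δ := by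
  refine le_csSup ⟨1, ?_⟩ ⟨p, hp, rfl⟩
  rintro _ ⟨q, hq, rfl⟩
  exact I.Psi_le_one hδ hq

/-- The interpolated contract loses at most `2 * s - s ^ 2` against `s ^ 2`-best responses. -/
theorem le_Psi_interpolate (I : PAInstance A O) {s : ℝ} (hs₀ : 0 < s) (hs₁ : s < 1)
    {p : O → ℝ} (hp : IsContract p) {a : A} (ha : a ∈ I.BR p) :
    I.uP p a - 2 * s + s ^ 2 ≤ I.Psi (s ^ 2) (fun ω => (1 - s) * p ω + s * I.r ω) := by
  refine le_csInf
    (((I.BR_nonempty _).mono (I.BR_subset_dBR (by positivity) _)).image _) ?_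
  rintro _ ⟨b, hb, rfl⟩
  have hba := hb a
  rw [uA_interpolate, uA_interpolate] at hba
  have hab := ha b
  have hlt : I.uP p a - s < I.uP p b := by
    refine lt_of_mul_lt_mul_left ?_ hs₀.le
    linarith
  rw [uP_interpolate]
  nlinarith [I.uP_le_one hp a]

end PAInstance

/-- For every δ ∈ (0,1), `OPT(δ) ≥ OPT - 2√δ + δ`. -/
theorem opt_robust_lower_bound {A O : Type*} [Fintype A] [Fintype O] [Nonempty A] [Nonempty O]
    (I : PAInstance A O) (δ : ℝ) (hδ : δ ∈ Set.Ioo (0 : ℝ) 1) :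
    I.OPTrob δ ≥ I.OPT - 2 * Real.sqrt δ + δ := by
  obtain ⟨hδ₀, hδ₁⟩ := hδ
  have hs₀ : 0 < √δ := Real.sqrt_pos.2 hδ₀
  have hs₁ : √δ < 1 := by rwa [Real.sqrt_lt' one_pos, one_pow]
  have hsq : √δ ^ 2 = δ := Real.sq_sqrt hδ₀.le
  suffices h : I.OPT ≤ I.OPTrob δ + 2 * √δ - δ by linarith
  refine csSup_le ⟨_, 0, fun _ => le_rfl, rfl⟩ ?_
  rintro _ ⟨p, hp, rfl⟩
  refine csSup_le ((I.BR_nonempty p).image _) ?_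
  rintro _ ⟨a, ha, rfl⟩
  have hle := I.le_Psi_interpolate hs₀ hs₁ hp ha
  rw [hsq] at hle
  have hq : PAInstance.IsContract (fun ω => (1 - √δ) * p ω + √δ * I.r ω) := fun ω =>
    add_nonneg (mul_nonneg (sub_nonneg.2 hs₁.le) (hp ω)) (mul_nonneg hs₀.le (I.r_mem ω).1)
  linarith [I.Psi_le_OPTrob hδ₀ hq]
end

section
/- For every δ ∈ (0,1) and every contract p ∈ ℝ^m_+, let p' = (1 − √δ) p + √δ r. Then for every best response a ∈ A(p) and every δ-best response a' ∈ A^δ(p') it holds that u^P(p, a) − u^P(p', a') ≤ 2√δ − δ. -/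
open scoped BigOperators

/-- Shifting a contract towards the rewards by `√δ` loses at most
`2√δ - δ` against any δ-best response to the shifted contract. -/
theorem shift_contract_robust {A O : Type*} [Fintype A] [Fintype O] [Nonempty A] [Nonempty O]
    (I : PAInstance A O) (δ : ℝ) (hδ : δ ∈ Set.Ioo (0 : ℝ) 1)
    (p : O → ℝ) (hp : PAInstance.IsContract p)
    (a : A) (ha : a ∈ I.BR p)
    (a' : A)
    (ha' : a' ∈ I.dBR δ (fun ω => (1 - Real.sqrt δ) * p ω + Real.sqrt δ * I.r ω)) :
    I.uP p a - I.uP (fun ω => (1 - Real.sqrt δ) * p ω + Real.sqrt δ * I.r ω) a'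
      ≤ 2 * Real.sqrt δ - δ := by
  obtain ⟨hδ0, hδ1⟩ := hδ
  set s := Real.sqrt δ
  have hs0 : 0 < s := Real.sqrt_pos.mpr hδ0
  have hss : s * s = δ := Real.mul_self_sqrt hδ0.le
  have hs1 : s < 1 := by nlinarith
  have hshift : ∀ b, ∑ ω, I.F b ω * ((1 - s) * p ω + s * I.r ω)
      = (1 - s) * ∑ ω, I.F b ω * p ω + s * ∑ ω, I.F b ω * I.r ω := by
    intro b
    rw [Finset.mul_sum, Finset.mul_sum, ← Finset.sum_add_distrib]
    exact Finset.sum_congr rfl fun ω _ => by ring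
  have hP : 0 ≤ ∑ ω, I.F a ω * p ω :=
    Finset.sum_nonneg fun ω _ => mul_nonneg (I.F_nonneg a ω) (hp ω)
  have hR : ∑ ω, I.F a ω * I.r ω ≤ 1 := by
    rw [← I.F_sum a]
    exact Finset.sum_le_sum fun ω _ => mul_le_of_le_one_right (I.F_nonneg a ω) (I.r_mem ω).2
  have hbr := ha a'
  have hdbr := ha' a
  simp only [PAInstance.uA, hshift] at hbr hdbr
  simp only [PAInstance.uP, mul_sub, Finset.sum_sub_distrib, hshift]
  generalize ∑ ω, I.F a ω * p ω = P at *
  generalize ∑ ω, I.F a ω * I.r ω = R at *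
  generalize ∑ ω, I.F a' ω * p ω = P' at *
  generalize ∑ ω, I.F a' ω * I.r ω = R' at *
  have hD : R - P - s < R' - P' := by
    refine lt_of_mul_lt_mul_left ?_ hs0.le
    linarith
  have h₁ : (1 - s) * (R - P - s) ≤ (1 - s) * (R' - P') :=
    mul_le_mul_of_nonneg_left hD.le (by linarith)
  have h₂ : s * (R - P) ≤ s * 1 := mul_le_mul_of_nonneg_left (by linarith) hs0.le
  linarith
end

section
/- For every δ ∈ (0,1), the optimal δ-robust value satisfies OPT(δ) ≤ max{0, SW − δ}, where SW = max_{a∈A} (F_a·r − c_a) is the maximum social welfare. -/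
open scoped BigOperators

namespace PAInstance

variable {A O : Type*} [Fintype A] [Fintype O] [Nonempty A] [Nonempty O]

/-- The principal's and the agent's utilities add up to the welfare of the action. -/
theorem uP_add_uA (I : PAInstance A O) (p : O → ℝ) (a : A) :
    I.uP p a + I.uA p a = (∑ ω, I.F a ω * I.r ω) - I.c a := by
  simp only [uP, uA, mul_sub, Finset.sum_sub_distrib]
  ring

theorem welfare_le_SW (I : PAInstance A O) (a : A) :
    (∑ ω, I.F a ω * I.r ω) - I.c a ≤ I.SW :=
  le_csSup (Set.finite_range _).bddAbove ⟨a, rfl⟩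

theorem uA_optOut_nonneg (I : PAInstance A O) {p : O → ℝ} (hp : IsContract p) :
    0 ≤ I.uA p I.optOut := by
  rw [uA, I.optOut_cost, sub_zero]
  exact Finset.sum_nonneg fun ω _ => mul_nonneg (I.F_nonneg _ ω) (hp ω)

theorem Psi_le_uP (I : PAInstance A O) {δ : ℝ} {p : O → ℝ} {a : A} (ha : a ∈ I.dBR δ p) :
    I.Psi δ p ≤ I.uP p a :=
  csInf_le (Set.toFinite _).bddBelow ⟨a, ha, rfl⟩

theorem Psi_le (I : PAInstance A O) {δ : ℝ} (hδ : 0 < δ) {p : O → ℝ} (hp : IsContract p) :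
    I.Psi δ p ≤ max 0 (I.SW - δ) := by
  have h₀ := I.uA_optOut_nonneg hp
  by_cases h : I.optOut ∈ I.dBR δ p
  · have hw := I.uP_add_uA p I.optOut
    rw [I.optOut_reward, I.optOut_cost] at hw
    exact le_max_of_le_left ((I.Psi_le_uP h).trans (by linarith))
  · simp only [dBR, Set.mem_ofPred_eq, not_forall, not_lt] at h
    obtain ⟨b, hb⟩ := h
    obtain ⟨a, ha⟩ := Finite.exists_max (I.uA p)
    have hmem : a ∈ I.dBR δ p := fun a' => by linarith [ha a']
    have hw := I.uP_add_uA p a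
    have hSW := I.welfare_le_SW a
    exact le_max_of_le_right ((I.Psi_le_uP hmem).trans (by linarith [ha b]))

end PAInstance

/-- For every δ ∈ (0,1), `OPT(δ) ≤ max {0, SW - δ}`. -/
theorem opt_robust_upper_bound {A O : Type*} [Fintype A] [Fintype O] [Nonempty A] [Nonempty O]
    (I : PAInstance A O) (δ : ℝ) (hδ : δ ∈ Set.Ioo (0 : ℝ) 1) :
    I.OPTrob δ ≤ max 0 (I.SW - δ) := by
  refine csSup_le ⟨_, 0, fun _ => le_rfl, rfl⟩ ?_
  rintro x ⟨p, hp, rfl⟩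
  exact I.Psi_le hδ.1 hp
end

section
/- The function δ ↦ OPT(δ) is continuous on the open interval (0,1). -/
open scoped BigOperators

namespace PAInstance

variable {A O : Type*} [Fintype A] [Fintype O] [Nonempty A] [Nonempty O]

theorem dBR_nonempty (I : PAInstance A O) {δ : ℝ} (hδ : 0 < δ) (p : O → ℝ) :
    (I.dBR δ p).Nonempty :=
  (I.BR_nonempty p).mono (I.BR_subset_dBR hδ p)

theorem dBR_mono (I : PAInstance A O) {δ δ' : ℝ} (h : δ ≤ δ') (p : O → ℝ) :
    I.dBR δ p ⊆ I.dBR δ' p := fun _ ha a' => by linarith [ha a']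

theorem le_Psi (I : PAInstance A O) {δ x : ℝ} (hδ : 0 < δ) {p : O → ℝ}
    (h : ∀ a ∈ I.dBR δ p, x ≤ I.uP p a) : x ≤ I.Psi δ p :=
  le_csInf ((I.dBR_nonempty hδ p).image _) (Set.forall_mem_image.2 h)

theorem OPTrob_le (I : PAInstance A O) {δ x : ℝ}
    (h : ∀ p, IsContract p → I.Psi δ p ≤ x) : I.OPTrob δ ≤ x :=
  csSup_le ⟨_, 0, fun _ => le_rfl, rfl⟩ (by rintro _ ⟨p, hp, rfl⟩; exact h p hp)

theorem OPTrob_anti (I : PAInstance A O) {δ δ' : ℝ} (hδ : 0 < δ) (h : δ ≤ δ') :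
    I.OPTrob δ' ≤ I.OPTrob δ :=
  I.OPTrob_le fun p hp =>
    (I.le_Psi hδ fun _ ha => I.Psi_le_uP (I.dBR_mono h p ha)).trans (I.Psi_le_OPTrob hδ hp)

/-- Moving a contract towards the reward vector scales the principal's utility. -/
theorem uP_add_smul (I : PAInstance A O) (p : O → ℝ) (ε : ℝ) (a : A) :
    I.uP (p + ε • (I.r - p)) a = (1 - ε) * I.uP p a := by
  simp only [uP, Finset.mul_sum]
  refine Finset.sum_congr rfl fun ω _ => ?_
  simp only [Pi.add_apply, Pi.smul_apply, Pi.sub_apply, smul_eq_mul]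
  ring

/-- Moving a contract towards the reward vector gives the agent a share of the principal's
utility. -/
theorem uA_add_smul (I : PAInstance A O) (p : O → ℝ) (ε : ℝ) (a : A) :
    I.uA (p + ε • (I.r - p)) a = I.uA p a + ε * I.uP p a := by
  simp only [uA, uP, Finset.mul_sum]
  rw [sub_add_eq_add_sub, ← Finset.sum_add_distrib]
  congr 1
  refine Finset.sum_congr rfl fun ω _ => ?_
  simp only [Pi.add_apply, Pi.smul_apply, Pi.sub_apply, smul_eq_mul]
  ring

theorem isContract_add_smul (I : PAInstance A O) {p : O → ℝ} (hp : IsContract p) {ε : ℝ}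
    (h0 : 0 ≤ ε) (h1 : ε ≤ 1) : IsContract (p + ε • (I.r - p)) := fun ω => by
  have h : (p + ε • (I.r - p)) ω = (1 - ε) * p ω + ε * I.r ω := by
    simp only [Pi.add_apply, Pi.smul_apply, Pi.sub_apply, smul_eq_mul]
    ring
  rw [h]
  exact add_nonneg (mul_nonneg (sub_nonneg.2 h1) (hp ω)) (mul_nonneg h0 (I.r_mem ω).1)

theorem Psi_sub_le_Psi_add_smul (I : PAInstance A O) {δ ε : ℝ} (hδ : 0 < δ) (h0 : 0 < ε)
    {p : O → ℝ} (hp : IsContract p) :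
    I.Psi δ p - 2 * ε ≤ I.Psi (δ + ε ^ 2) (p + ε • (I.r - p)) := by
  refine I.le_Psi (by positivity) fun a ha => ?_
  have key : I.Psi δ p - ε ≤ I.uP p a := by
    by_cases hap : a ∈ I.dBR δ p
    · linarith [I.Psi_le_uP hap]
    · simp only [dBR, Set.mem_ofPred_eq, not_forall, not_lt] at hap
      obtain ⟨b, hb⟩ := hap
      obtain ⟨s, hs⟩ := I.BR_nonempty p
      have hΨ := I.Psi_le_uP (I.BR_subset_dBR hδ p hs)
      have hsa := ha s
      rw [uA_add_smul, uA_add_smul] at hsa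
      have hlt : ε * (I.uP p s - ε) < ε * I.uP p a := by linarith [hs b]
      linarith [lt_of_mul_lt_mul_left hlt h0.le]
  rw [uP_add_smul]
  nlinarith [I.uP_le_one hp a]

/-- The robust value is Hölder continuous with exponent `1 / 2`. -/
theorem abs_OPTrob_sub_le (I : PAInstance A O) {δ δ' : ℝ} (hδ : 0 < δ) (hδ' : 0 < δ')
    (h : |δ' - δ| ≤ 1) : |I.OPTrob δ' - I.OPTrob δ| ≤ 2 * √|δ' - δ| := by
  wlog hle : δ ≤ δ' generalizing δ δ'
  · rw [abs_sub_comm, abs_sub_comm δ'] at *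
    exact this hδ' hδ h (le_of_not_ge hle)
  rcases hle.eq_or_lt with rfl | hlt
  · simp
  rw [abs_of_pos (sub_pos.2 hlt)] at *
  rw [abs_of_nonpos (sub_nonpos.2 (I.OPTrob_anti hδ hle)), neg_sub, sub_le_iff_le_add]
  refine I.OPTrob_le fun p hp => ?_
  have h0 : 0 < √(δ' - δ) := Real.sqrt_pos.2 (sub_pos.2 hlt)
  have h1 : √(δ' - δ) ≤ 1 := Real.sqrt_le_one.2 h
  have hΨ := I.Psi_sub_le_Psi_add_smul hδ h0 hp
  rw [Real.sq_sqrt (sub_pos.2 hlt).le, add_sub_cancel] at hΨ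
  linarith [I.Psi_le_OPTrob hδ' (I.isContract_add_smul hp h0.le h1)]

end PAInstance

/-- `δ ↦ OPT(δ)` is continuous on `(0,1)`. -/
theorem opt_robust_continuous {A O : Type*} [Fintype A] [Fintype O] [Nonempty A] [Nonempty O]
    (I : PAInstance A O) :
    ContinuousOn (fun δ => I.OPTrob δ) (Set.Ioo (0 : ℝ) 1) := by
  intro δ hδ
  refine tendsto_iff_dist_tendsto_zero.2 ?_
  have hlim : Filter.Tendsto (fun x : ℝ => 2 * √|x - δ|)
      (nhdsWithin δ (Set.Ioo 0 1)) (nhds 0) := by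
    have hc : Continuous fun x : ℝ => 2 * √|x - δ| := by fun_prop
    simpa using (hc.tendsto δ).mono_left nhdsWithin_le_nhds
  refine squeeze_zero' (Filter.Eventually.of_forall fun _ => dist_nonneg) ?_ hlim
  filter_upwards [self_mem_nhdsWithin] with x hx
  rw [Real.dist_eq]
  exact I.abs_OPTrob_sub_le hδ.1 hx.1
    (abs_le.2 ⟨by linarith [hx.1, hδ.2], by linarith [hx.2, hδ.1]⟩)
end

section
/- Consider a hidden-action principal-agent problem with a finite set Θ of agent types and a distribution λ ∈ Δ(Θ). Fix δ ∈ (0,1) and ε = 1/K for an integer K ≥ 1 with 2ε < 1 and δ + 2ε < 1, and let B_ε = {p ∈ [0,1]^m : p_ω ∈ {0, ε, 2ε, …, 1} for all ω ∈ Ω}. Then there exists p̄ ∈ B_ε such that Σ_{θ∈Θ} λ_θ · u^P(p̄, a^{θ,δ}(p̄), θ) ≥ OPT(C, δ) − 2√(2ε), where OPT(C, δ) = max_{p ∈ [0,1]^m} Σ_{θ∈Θ} λ_θ · u^P(p, a^{θ,δ}(p), θ). -/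
open scoped BigOperators

/-- A hidden-action principal-agent problem with a finite set `Θ` of agent
types distributed according to `lam`. -/
structure TypedPAInstance (A O Θ : Type*) [Fintype A] [Fintype O] [Fintype Θ]
    [Nonempty A] [Nonempty O] [Nonempty Θ] where
  /-- `F θ a ω` is the probability that action `a` of type `θ` yields outcome `ω`. -/
  F : Θ → A → O → ℝ
  /-- principal's reward vector -/
  r : O → ℝ
  /-- agent's cost vector, per type -/
  c : Θ → A → ℝ
  /-- distribution over types -/
  lam : Θ → ℝ
  F_nonneg : ∀ θ a ω, 0 ≤ F θ a ω
  F_sum : ∀ θ a, ∑ ω, F θ a ω = 1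
  r_mem : ∀ ω, r ω ∈ Set.Icc (0 : ℝ) 1
  c_mem : ∀ θ a, c θ a ∈ Set.Icc (0 : ℝ) 1
  lam_nonneg : ∀ θ, 0 ≤ lam θ
  lam_sum : ∑ θ, lam θ = 1
  /-- the opt-out action -/
  optOut : A
  optOut_cost : ∀ θ, c θ optOut = 0
  optOut_reward : ∀ θ, ∑ ω, F θ optOut ω * r ω = 0

namespace TypedPAInstance

variable {A O Θ : Type*} [Fintype A] [Fintype O] [Fintype Θ]
  [Nonempty A] [Nonempty O] [Nonempty Θ]

/-- Agent's expected utility `u^A(p, a, θ)`. -/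
def uA (I : TypedPAInstance A O Θ) (θ : Θ) (p : O → ℝ) (a : A) : ℝ :=
  (∑ ω, I.F θ a ω * p ω) - I.c θ a

/-- Principal's expected utility `u^P(p, a, θ)`. -/
def uP (I : TypedPAInstance A O Θ) (θ : Θ) (p : O → ℝ) (a : A) : ℝ :=
  ∑ ω, I.F θ a ω * (I.r ω - p ω)

/-- Best responses `A^θ(p)` of type `θ`. -/
def BR (I : TypedPAInstance A O Θ) (θ : Θ) (p : O → ℝ) : Set A :=
  {a | ∀ a', I.uA θ p a' ≤ I.uA θ p a}

/-- δ-best responses `A^{θ,δ}(p)` of type `θ`. -/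
def dBR (I : TypedPAInstance A O Θ) (θ : Θ) (δ : ℝ) (p : O → ℝ) : Set A :=
  {a | ∀ a', I.uA θ p a' - δ < I.uA θ p a}

/-- The principal's expected utility `∑_θ λ_θ u^P(p, a^{θ,δ}(p), θ)` when each
type plays the worst δ-best response. -/
noncomputable def robVal (I : TypedPAInstance A O Θ) (δ : ℝ) (p : O → ℝ) : ℝ :=
  ∑ θ, I.lam θ * sInf (I.uP θ p '' I.dBR θ δ p)

/-- `OPT(C, δ)`: the optimal δ-robust value over the hypercube `C = [0,1]^m`. -/
noncomputable def OPTrobC (I : TypedPAInstance A O Θ) (δ : ℝ) : ℝ :=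
  sSup {x | ∃ p : O → ℝ, (∀ ω, p ω ∈ Set.Icc (0 : ℝ) 1) ∧ x = I.robVal δ p}

/-- The principal's expected utility `∑_θ λ_θ u^P(p, a^θ(p), θ)` when each type
plays a best response breaking ties in favor of the principal. -/
noncomputable def nonRobVal (I : TypedPAInstance A O Θ) (p : O → ℝ) : ℝ :=
  ∑ θ, I.lam θ * sSup (I.uP θ p '' I.BR θ p)

/-- `OPT(C)`: the optimal non-robust value over the hypercube `C = [0,1]^m`. -/
noncomputable def OPTC (I : TypedPAInstance A O Θ) : ℝ :=
  sSup {x | ∃ p : O → ℝ, (∀ ω, p ω ∈ Set.Icc (0 : ℝ) 1) ∧ x = I.nonRobVal p}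

end TypedPAInstance

namespace TypedPAInstance

variable {A O Θ : Type*} [Fintype A] [Fintype O] [Fintype Θ]
  [Nonempty A] [Nonempty O] [Nonempty Θ]

theorem exists_mem_BR (I : TypedPAInstance A O Θ) (θ : Θ) (p : O → ℝ) :
    ∃ b, b ∈ I.BR θ p :=
  Finite.exists_max (I.uA θ p)

theorem BR_subset_dBR (I : TypedPAInstance A O Θ) (θ : Θ) {δ : ℝ} (hδ : 0 < δ) (p : O → ℝ) :
    I.BR θ p ⊆ I.dBR θ δ p :=
  fun _ hb a => by linarith [hb a]

theorem sInf_uP_le (I : TypedPAInstance A O Θ) {θ : Θ} {δ : ℝ} {p : O → ℝ} {a : A}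
    (ha : a ∈ I.dBR θ δ p) : sInf (I.uP θ p '' I.dBR θ δ p) ≤ I.uP θ p a :=
  csInf_le (Set.toFinite _).bddBelow (Set.mem_image_of_mem _ ha)

theorem sum_F_mul_le (I : TypedPAInstance A O Θ) (θ : Θ) (a : A) {f : O → ℝ} {C : ℝ}
    (hf : ∀ ω, f ω ≤ C) : ∑ ω, I.F θ a ω * f ω ≤ C := by
  calc ∑ ω, I.F θ a ω * f ω ≤ ∑ ω, I.F θ a ω * C :=
        Finset.sum_le_sum fun ω _ => mul_le_mul_of_nonneg_left (hf ω) (I.F_nonneg θ a ω)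
    _ = C := by rw [← Finset.sum_mul, I.F_sum, one_mul]

theorem uP_le_one (I : TypedPAInstance A O Θ) (θ : Θ) {p : O → ℝ} (hp : ∀ ω, 0 ≤ p ω)
    (a : A) : I.uP θ p a ≤ 1 :=
  I.sum_F_mul_le θ a fun ω => by linarith [(I.r_mem ω).2, hp ω]

/-- Moving a contract a fraction `s` towards the reward vector and then lowering each payment
by at most `ε` costs the principal at most `s + ε / s` for each type. -/
theorem sInf_uP_perturb (I : TypedPAInstance A O Θ) (θ : Θ) {δ s ε : ℝ} (hδ : 0 < δ)
    (hs : 0 < s) (hs1 : s ≤ 1) (hε : 0 ≤ ε) {p e : O → ℝ} (hp : ∀ ω, 0 ≤ p ω)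
    (he0 : ∀ ω, 0 ≤ e ω) (heε : ∀ ω, e ω ≤ ε) :
    sInf (I.uP θ p '' I.dBR θ δ p) - (s + ε / s) ≤
      sInf (I.uP θ (fun ω => p ω + s * (I.r ω - p ω) - e ω) ''
        I.dBR θ δ (fun ω => p ω + s * (I.r ω - p ω) - e ω)) := by
  set q : O → ℝ := fun ω => p ω + s * (I.r ω - p ω) - e ω with hq
  set W := sInf (I.uP θ p '' I.dBR θ δ p)
  have hA : ∀ a, I.uA θ q a =
      I.uA θ p a + s * I.uP θ p a - ∑ ω, I.F θ a ω * e ω := fun a => by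
    simp only [uA, uP, hq, mul_add, mul_sub, Finset.sum_add_distrib, Finset.sum_sub_distrib,
      Finset.mul_sum, mul_left_comm s]
    ring
  have hP : ∀ a, I.uP θ q a = (1 - s) * I.uP θ p a + ∑ ω, I.F θ a ω * e ω := fun a => by
    simp only [uP, hq, Finset.mul_sum, ← Finset.sum_add_distrib]
    exact Finset.sum_congr rfl fun ω _ => by ring
  have hE0 : ∀ a, 0 ≤ ∑ ω, I.F θ a ω * e ω := fun a =>
    Finset.sum_nonneg fun ω _ => mul_nonneg (I.F_nonneg θ a ω) (he0 ω)
  obtain ⟨b, hb⟩ := I.exists_mem_BR θ p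
  have hWb : W ≤ I.uP θ p b := I.sInf_uP_le (I.BR_subset_dBR θ hδ p hb)
  have hW1 : W ≤ 1 := hWb.trans (I.uP_le_one θ hp b)
  have hεs : 0 ≤ ε / s := by positivity
  obtain ⟨b', hb'⟩ := I.exists_mem_BR θ q
  refine le_csInf ⟨_, Set.mem_image_of_mem _ (I.BR_subset_dBR θ hδ q hb')⟩ ?_
  rintro _ ⟨a, ha, rfl⟩
  have key : W - ε / s ≤ I.uP θ p a := by
    by_cases hap : a ∈ I.dBR θ δ p
    · linarith [I.sInf_uP_le hap]
    · obtain ⟨a', ha'⟩ : ∃ a', I.uA θ p a ≤ I.uA θ p a' - δ := by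
        simpa [dBR] using hap
      have h1 := ha b
      rw [hA, hA] at h1
      have h2 : s * (I.uP θ p b - I.uP θ p a) ≤ ε := by
        linarith [hb a', I.sum_F_mul_le θ b heε, hE0 a]
      have h3 : I.uP θ p b - I.uP θ p a ≤ ε / s := by
        rw [le_div_iff₀ hs]
        linarith
      linarith
  rw [hP]
  nlinarith [hE0 a, mul_le_mul_of_nonneg_left key (sub_nonneg.2 hs1), mul_nonneg hs.le hεs,
    mul_nonneg hs.le (sub_nonneg.2 hW1)]

theorem robVal_perturb (I : TypedPAInstance A O Θ) {δ s ε : ℝ} (hδ : 0 < δ)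
    (hs : 0 < s) (hs1 : s ≤ 1) (hε : 0 ≤ ε) {p e : O → ℝ} (hp : ∀ ω, 0 ≤ p ω)
    (he0 : ∀ ω, 0 ≤ e ω) (heε : ∀ ω, e ω ≤ ε) :
    I.robVal δ p - (s + ε / s) ≤ I.robVal δ (fun ω => p ω + s * (I.r ω - p ω) - e ω) := by
  calc I.robVal δ p - (s + ε / s)
      = ∑ θ, I.lam θ * (sInf (I.uP θ p '' I.dBR θ δ p) - (s + ε / s)) := by
        simp only [robVal, mul_sub, Finset.sum_sub_distrib, ← Finset.sum_mul, I.lam_sum, one_mul]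
    _ ≤ _ := Finset.sum_le_sum fun θ _ => mul_le_mul_of_nonneg_left
        (I.sInf_uP_perturb θ hδ hs hs1 hε hp he0 heε) (I.lam_nonneg θ)

end TypedPAInstance


/-- On the uniform grid `B_ε` with step `ε = 1/K`, there is a
contract whose robust value is within `2√(2ε)` of `OPT(C, δ)`. -/
theorem grid_near_optimal {A O Θ : Type*} [Fintype A] [Fintype O] [Fintype Θ]
    [Nonempty A] [Nonempty O] [Nonempty Θ]
    (I : TypedPAInstance A O Θ) (δ : ℝ) (hδ : δ ∈ Set.Ioo (0 : ℝ) 1)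
    (K : ℕ) (hK : 1 ≤ K) (ε : ℝ) (hε : ε = 1 / (K : ℝ))
    (h2ε : 2 * ε < 1) (hsum : δ + 2 * ε < 1) :
    ∃ pbar : O → ℝ, (∀ ω, ∃ k : ℕ, k ≤ K ∧ pbar ω = (k : ℝ) * ε) ∧
      I.robVal δ pbar ≥ I.OPTrobC δ - 2 * Real.sqrt (2 * ε) := by
  have hK0 : (0 : ℝ) < K := by exact_mod_cast hK
  have hε0 : 0 < ε := by rw [hε]; positivity
  have hKε : (K : ℝ) * ε = 1 := by rw [hε]; field_simp
  set s := Real.sqrt (2 * ε) with hs_def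
  have hs : 0 < s := Real.sqrt_pos.2 (by linarith)
  have hss : s * s = 2 * ε := Real.mul_self_sqrt (by linarith)
  have hs1 : s ≤ 1 := by nlinarith
  have hεs : ε / s = s / 2 := by
    rw [div_eq_iff hs.ne']
    linarith
  obtain ⟨_, ⟨p, hp, rfl⟩, hpV⟩ : ∃ x ∈ {x | ∃ p : O → ℝ,
      (∀ ω, p ω ∈ Set.Icc (0 : ℝ) 1) ∧ x = I.robVal δ p}, I.OPTrobC δ - s / 2 < x :=
    exists_lt_of_lt_csSup ⟨_, fun _ => 0, by simp, rfl⟩ (sub_lt_self _ (by linarith))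
  let q : O → ℝ := fun ω => p ω + s * (I.r ω - p ω)
  have hq0 : ∀ ω, 0 ≤ q ω := fun ω => by
    simp only [q]
    nlinarith [mul_nonneg hs.le (I.r_mem ω).1, mul_nonneg (sub_nonneg.2 hs1) (hp ω).1]
  have hq1 : ∀ ω, q ω ≤ 1 := fun ω => by
    simp only [q]
    nlinarith [mul_nonneg hs.le (sub_nonneg.2 (I.r_mem ω).2),
      mul_nonneg (sub_nonneg.2 hs1) (sub_nonneg.2 (hp ω).2)]
  let k : O → ℕ := fun ω => ⌊q ω * K⌋₊
  have hk : ∀ ω, (k ω : ℝ) ≤ q ω * K := fun ω => Nat.floor_le (mul_nonneg (hq0 ω) hK0.le)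
  have hk' : ∀ ω, q ω * K < k ω + 1 := fun ω => Nat.lt_floor_add_one _
  have hqK : ∀ ω, q ω * K * ε = q ω := fun ω => by rw [mul_assoc, hKε, mul_one]
  refine ⟨fun ω => k ω * ε, fun ω => ⟨k ω, ?_, rfl⟩, ?_⟩
  · exact_mod_cast (hk ω).trans (mul_le_of_le_one_left hK0.le (hq1 ω))
  · have h := I.robVal_perturb (e := fun ω => q ω - k ω * ε) hδ.1 hs hs1 hε0.le
      (fun ω => (hp ω).1)
      (fun ω => by linarith [mul_le_mul_of_nonneg_right (hk ω) hε0.le, hqK ω])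
      (fun ω => by linarith [mul_le_mul_of_nonneg_right (hk' ω).le hε0.le, hqK ω])
    simp only [q, sub_sub_cancel] at h
    rw [hεs] at h
    simp only [ge_iff_le]
    linarith
end
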